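/- Let L be a Lie ring (a Lie algebra over ℤ, or over any commutative ring). For a nonempty list [x₁, …, x_k] of elements of L define the left-nested iterated bracket C([x₁]) = x₁ and C([x₁, …, x_k]) = ⁅C([x₁, …, x_{k−1}]), x_k⁆. Then for any two nonempty lists l₁ and l₂ of elements of L, the bracket ⁅C(l₁), C(l₂)⁆ lies in the additive subgroup of L generated by the set { C(l) : l is a permutation of the concatenated list l₁ ++ l₂ }. -/

import Mathlib

/-- The left-nested iterated bracket `C([x₁, …, x_k]) = ⁅⋯⁅⁅x₁, x₂⁆, x₃⁆, …, x_k⁆`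
of a list of elements of a Lie ring (with the convention `0` on the empty list). -/
def iterBracket {L : Type*} [LieRing L] : List L → L
  | [] => 0
  | a :: t => t.foldl (fun x y => ⁅x, y⁆) a

theorem iterBracket_concat {L : Type*} [LieRing L] (l : List L) (h : l ≠ []) (y : L) :
    iterBracket (l ++ [y]) = ⁅iterBracket l, y⁆ := by
  cases l with
  | nil => exact absurd rfl h
  | cons a t => simp [iterBracket, List.foldl_append]

/-- the bracket of two iterated (left-nested) brackets `C(l₁)` and `C(l₂)`,
for nonempty lists `l₁, l₂`, lies in the additive subgroup generated by the iterated
brackets `C(l)` where `l` ranges over the permutations of `l₁ ++ l₂`. -/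
theorem lie_iterBracket_mem_closure {L : Type*} [LieRing L]
    (l₁ l₂ : List L) (h₁ : l₁ ≠ []) (h₂ : l₂ ≠ []) :
    ⁅iterBracket l₁, iterBracket l₂⁆ ∈
      AddSubgroup.closure
        { x : L | ∃ l : List L, l.Perm (l₁ ++ l₂) ∧ x = iterBracket l } := by
  induction l₂ using List.reverseRecOn generalizing l₁ with
  | nil => exact absurd rfl h₂
  | append_singleton t y ih =>
    by_cases ht : t = []
    · subst ht
      apply AddSubgroup.subset_closure
      exact ⟨l₁ ++ [y], by simp, by rw [iterBracket_concat l₁ h₁]; simp [iterBracket]⟩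
    · rw [iterBracket_concat t ht, leibniz_lie, ← lie_skew (iterBracket t),
        ← iterBracket_concat l₁ h₁ y]
      apply AddSubgroup.add_mem
      · have key := ih l₁ h₁ ht
        generalize ⁅iterBracket l₁, iterBracket t⁆ = z at key ⊢
        induction key using AddSubgroup.closure_induction with
        | mem x hx =>
          obtain ⟨l, hl, rfl⟩ := hx
          have hne : l ≠ [] := by
            rintro rfl
            have := hl.symm.eq_nil
            simp_all
          apply AddSubgroup.subset_closure
          refine ⟨l ++ [y], ?_, (iterBracket_concat l hne y).symm⟩
          rw [← List.append_assoc]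
          exact hl.append_right [y]
        | zero => rw [zero_lie]; exact AddSubgroup.zero_mem _
        | add a b _ _ ha hb => rw [add_lie]; exact AddSubgroup.add_mem _ ha hb
        | neg a _ ha => rw [neg_lie]; exact AddSubgroup.neg_mem _ ha
      · apply AddSubgroup.neg_mem
        refine AddSubgroup.closure_mono ?_ (ih (l₁ ++ [y]) (by simp) ht)
        rintro x ⟨l, hl, rfl⟩
        refine ⟨l, hl.trans ?_, rfl⟩
        rw [List.append_assoc]
        exact List.perm_append_comm.append_left l₁
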